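/- arXiv:1111.6892 — 3 statements merged into one kernel-verified Lean document; each statement's English description precedes it below -/
import Mathlib

section
/- Let C be a pretriangulated category and S a negative class of objects of C, i.e., for all N, N′ ∈ S and every integer i > 0, every morphism N ⟶ N′⟦i⟧ is zero. Let M be an object of C that belongs to every thick triangulated class of objects of C containing S. Then there exists an integer j (depending on M) such that for every N ∈ S and every integer i > j, every morphism N ⟶ M⟦i⟧ is zero. -/
open CategoryTheory CategoryTheory.Limits CategoryTheory.Pretriangulated

universe v u

variable {C : Type u} [Category.{v} C] [HasZeroObject C] [HasShift C ℤ]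
  [Preadditive C] [∀ n : ℤ, (shiftFunctor C n).Additive] [Pretriangulated C]

/-- The vanishing condition `V_S(j)`: for every `N ∈ S` and every integer `i > j`,
every morphism `N ⟶ O⟦i⟧` is zero. -/
def VanishCond (S : Set C) (j : ℤ) (O : C) : Prop :=
  ∀ N ∈ S, ∀ i : ℤ, j < i → ∀ f : N ⟶ O⟦i⟧, f = 0

/-- A thick triangulated class of objects: contains the zero object, closed under
isomorphisms, all shifts, extensions and retracts. -/
def IsThickClass (T : Set C) : Prop :=
  (∀ O : C, IsZero O → O ∈ T) ∧
  (∀ O O' : C, (O ≅ O') → O' ∈ T → O ∈ T) ∧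
  (∀ O ∈ T, ∀ n : ℤ, O⟦n⟧ ∈ T) ∧
  (∀ (A B Z : C) (f : A ⟶ B) (g : B ⟶ Z) (h : Z ⟶ A⟦(1 : ℤ)⟧),
    Triangle.mk f g h ∈ (distTriang C) → A ∈ T → Z ∈ T → B ∈ T) ∧
  (∀ O O' : C, O' ∈ T → (∃ (s : O ⟶ O') (r : O' ⟶ O), s ≫ r = 𝟙 O) → O ∈ T)

namespace VanishCond

variable {S : Set C}

omit [HasZeroObject C] [∀ n : ℤ, (shiftFunctor C n).Additive] [Pretriangulated C] in
theorem mono {j k : ℤ} (hjk : j ≤ k) {O : C} (h : VanishCond S j O) : VanishCond S k O :=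
  fun N hN i hi f => h N hN i (hjk.trans_lt hi) f

omit [HasZeroObject C] [Pretriangulated C] in
theorem of_isZero {O : C} (hO : IsZero O) (j : ℤ) : VanishCond S j O :=
  fun _ _ i _ _ => ((shiftFunctor C i).map_isZero hO).eq_of_tgt _ _

omit [HasZeroObject C] [∀ n : ℤ, (shiftFunctor C n).Additive] [Pretriangulated C] in
theorem of_retract {j : ℤ} {O O' : C} (s : O ⟶ O') (r : O' ⟶ O) (hsr : s ≫ r = 𝟙 O)
    (h : VanishCond S j O') : VanishCond S j O := by
  intro N hN i hi f
  have hf : f ≫ s⟦i⟧' = 0 := h N hN i hi _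
  rw [← Category.comp_id f, ← (shiftFunctor C i).map_id, ← hsr, Functor.map_comp, reassoc_of% hf, zero_comp]

omit [HasZeroObject C] [∀ n : ℤ, (shiftFunctor C n).Additive] [Pretriangulated C] in
theorem shift {j : ℤ} {O : C} (h : VanishCond S j O) (n : ℤ) :
    VanishCond S (j - n) (O⟦n⟧) := by
  intro N hN i hi f
  rw [← cancel_mono ((shiftFunctorAdd C n i).inv.app O), zero_comp]
  exact h N hN (n + i) (by lia) _

theorem extension {j : ℤ} {T : Triangle C} (hT : T ∈ distTriang C)
    (h₁ : VanishCond S j T.obj₁) (h₃ : VanishCond S j T.obj₃) : VanishCond S j T.obj₂ := by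
  intro N hN i hi f
  obtain ⟨g, rfl⟩ := Triangle.coyoneda_exact₂ _ (Triangle.shift_distinguished T hT i) f
    (h₃ N hN i hi _)
  have hg : g = 0 := h₁ N hN i hi g
  rw [hg]
  exact zero_comp

end VanishCond

theorem isThickClass_setOf_exists_vanishCond (S : Set C) :
    IsThickClass {O : C | ∃ j : ℤ, VanishCond S j O} := by
  refine ⟨fun O hO => ⟨0, .of_isZero hO 0⟩, ?_, ?_, ?_, ?_⟩
  · rintro O O' e ⟨j, h⟩
    exact ⟨j, h.of_retract e.hom e.inv e.hom_inv_id⟩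
  · rintro O ⟨j, h⟩ n
    exact ⟨j - n, h.shift n⟩
  · rintro A B Z f g h hT ⟨j, hA⟩ ⟨k, hZ⟩
    exact ⟨max j k, .extension hT (hA.mono (le_max_left j k)) (hZ.mono (le_max_right j k))⟩
  · rintro O O' ⟨j, h⟩ ⟨s, r, hsr⟩
    exact ⟨j, h.of_retract s r hsr⟩

theorem exists_vanishing_of_negative (S : Set C)
    (hneg : ∀ N ∈ S, ∀ N' ∈ S, ∀ i : ℤ, 0 < i → ∀ f : N ⟶ N'⟦i⟧, f = 0)
    (M : C) (hM : ∀ T : Set C, IsThickClass T → S ⊆ T → M ∈ T) :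
    ∃ j : ℤ, ∀ N ∈ S, ∀ i : ℤ, j < i → ∀ f : N ⟶ M⟦i⟧, f = 0 :=
  hM _ (isThickClass_setOf_exists_vanishCond S) fun N' hN' =>
    ⟨0, fun N hN i hi f => hneg N hN N' hN' i hi f⟩
end

section
/- Let C be a pretriangulated category, S a class of objects of C, and M an object of C that belongs to every thick triangulated class of objects of C containing S. If M is not a zero object, then there exist an object N ∈ S, an integer j, and a nonzero morphism f : N⟦j⟧ ⟶ M. -/
open CategoryTheory CategoryTheory.Limits CategoryTheory.Pretriangulated

universe v u

variable {C : Type u} [Category.{v} C] [HasZeroObject C] [HasShift C ℤ]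
  [Preadditive C] [∀ n : ℤ, (shiftFunctor C n).Additive] [Pretriangulated C]

/-- The left orthogonal of a shift-stable property is a thick triangulated class. -/
lemma isThickClass_leftOrthogonal (P : ObjectProperty C) [P.IsStableUnderShift ℤ] :
    IsThickClass {X : C | P.leftOrthogonal X} := by
  refine ⟨fun O hO _ f _ ↦ hO.eq_of_src f 0, fun O O' e h ↦ P.leftOrthogonal.prop_of_iso e.symm h,
    fun O hO n ↦ P.leftOrthogonal.le_shift n O hO,
    fun A B Z f g h hT hA hZ ↦ P.leftOrthogonal.ext_of_isTriangulatedClosed₂ _ hT hA hZ, ?_⟩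
  rintro O O' h ⟨s, r, hsr⟩ Y f hY
  rw [← Category.id_comp f, ← hsr, Category.assoc, h (r ≫ f) hY, comp_zero]

theorem exists_nonzero_map_of_not_isZero (S : Set C) (M : C)
    (hM : ∀ T : Set C, IsThickClass T → S ⊆ T → M ∈ T)
    (hne : ¬ IsZero M) :
    ∃ N ∈ S, ∃ j : ℤ, ∃ f : N⟦j⟧ ⟶ M, f ≠ 0 := by
  by_contra! h
  let P : ObjectProperty C := (ObjectProperty.singleton M).shiftClosure ℤ
  have hP : S ⊆ {X : C | P.leftOrthogonal X} := by
    rintro N hN Y f ⟨_, n, e, ⟨⟩⟩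
    rw [← cancel_mono e.hom, zero_comp]
    apply (shiftFunctor C (-n)).map_injective
    rw [← cancel_mono ((shiftFunctorCompIsoId C n (-n) (by simp)).hom.app M),
      Functor.map_zero, zero_comp]
    exact h N hN (-n) _
  have hM' : P.leftOrthogonal M := hM _ (isThickClass_leftOrthogonal P) hP
  exact hne ((IsZero.iff_id_eq_zero M).2 (hM' (𝟙 M)
    (ObjectProperty.le_shiftClosure _ M (by simp))))
end

section
/- Let C be a pretriangulated category, let A and B be classes of objects of C such that for every a ∈ A and every b ∈ B every morphism a ⟶ b⟦1⟧ is zero, and let S ⊆ A be a class of objects. Let M be an object of C that belongs to every thick triangulated class of objects of C containing S, and suppose that for every integer l the object M⟦l⟧ is isomorphic to an object of B. Then M is a zero object of C. -/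
open CategoryTheory CategoryTheory.Limits CategoryTheory.Pretriangulated

universe v u

variable {C : Type u} [Category.{v} C] [HasZeroObject C] [HasShift C ℤ]
  [Preadditive C] [∀ n : ℤ, (shiftFunctor C n).Additive] [Pretriangulated C]

/-- The objects all of whose morphisms to shifts of `M` vanish form a thick class. -/
theorem isThickClass_shiftLeftOrthogonal (M : C) :
    IsThickClass {N : C | ∀ (i : ℤ) (f : N ⟶ M⟦i⟧), f = 0} := by
  refine ⟨fun O hO i f => hO.eq_of_src _ _, ?_, ?_, ?_, ?_⟩
  · intro O O' e hO' i f
    rw [← cancel_epi e.inv, hO' i (e.inv ≫ f), comp_zero]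
  · intro O hO n i f
    apply (shiftFunctor C (-n)).map_injective
    rw [Functor.map_zero,
      ← cancel_epi ((shiftFunctorCompIsoId C n (-n) (add_neg_cancel n)).inv.app O),
      ← cancel_mono ((shiftFunctorAdd C i (-n)).inv.app M), comp_zero, zero_comp]
    exact hO (i + -n) _
  · intro X Y Z f g h hT hX hZ i φ
    obtain ⟨ψ, hψ⟩ := Triangle.yoneda_exact₂ _ hT φ (hX i (f ≫ φ))
    have hψ0 : φ = g ≫ ψ := hψ
    rw [hψ0, hZ i ψ, comp_zero]
  · rintro O O' hO' ⟨s, r, hsr⟩ i f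
    rw [← Category.id_comp f, ← hsr, Category.assoc, hO' i (r ≫ f), comp_zero]

theorem isZero_of_orthogonal_generated (A B : Set C)
    (horth : ∀ a ∈ A, ∀ b ∈ B, ∀ f : a ⟶ b⟦(1 : ℤ)⟧, f = 0)
    (S : Set C) (hSA : S ⊆ A) (M : C)
    (hM : ∀ T : Set C, IsThickClass T → S ⊆ T → M ∈ T)
    (hB : ∀ l : ℤ, ∃ b ∈ B, Nonempty ((M⟦l⟧) ≅ b)) :
    IsZero M := by
  have hS : S ⊆ {N : C | ∀ (i : ℤ) (f : N ⟶ M⟦i⟧), f = 0} := by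
    intro N hN i f
    obtain ⟨b, hb, ⟨e⟩⟩ := hB (i - 1)
    rw [← cancel_mono ((shiftFunctorAdd' C (i - 1) 1 i (sub_add_cancel i 1)).hom.app M),
      ← cancel_mono (e.hom⟦(1 : ℤ)⟧'), zero_comp, zero_comp]
    exact horth N (hSA hN) b hb _
  have hzero := hM _ (isThickClass_shiftLeftOrthogonal M) hS 0 ((shiftFunctorZero C ℤ).inv.app M)
  rw [IsZero.iff_id_eq_zero, ← cancel_mono ((shiftFunctorZero C ℤ).inv.app M), zero_comp,
    Category.id_comp]
  exact hzero
end
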